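/- arXiv:2605.05189 — 2 statements merged into one kernel-verified Lean document; each statement's English description precedes it below -/
import Mathlib

section
/- For every ε > 0 and every c₀ > 0 there exists a constant c > 0 such that for all sufficiently large d the following holds: if n ≥ c₀ d²/log d and the data follow the Gaussian model, then P( ‖U V^⊤‖_F ≤ (1+ε)√n ) ≥ 1 − e^{−c d}, where ‖·‖_F is the Frobenius norm. -/
open MeasureTheory ProbabilityTheory Filter Topology Matrix

noncomputable section

/-- The law `N(0, I_d/d)` on `ℝ^d`. -/
def stdGaussianVec (d : ℕ) : Measure (Fin d → ℝ) :=
  Measure.pi fun _ => gaussianReal 0 (d : NNReal)⁻¹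

/-- The Gaussian model: `u_1, …, u_n, v_1, …, v_n` mutually independent `N(0, I_d/d)`. -/
def gaussianModel (d n : ℕ) :
    Measure ((Fin n → Fin d → ℝ) × (Fin n → Fin d → ℝ)) :=
  (Measure.pi fun _ : Fin n => stdGaussianVec d).prod
    (Measure.pi fun _ : Fin n => stdGaussianVec d)


lemma aux_inv_le_exp {x : ℝ} (h0 : 0 ≤ x) (h1 : x ≤ 1 / 4) :
    1 ≤ (1 - x) * Real.exp (x + x ^ 2) := by
  have h := Real.quadratic_le_exp_of_nonneg (x := x + x ^ 2) (by positivity)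
  have : 1 ≤ (1 - x) * (1 + (x + x ^ 2) + (x + x ^ 2) ^ 2 / 2) := by
    have e : (1 - x) * (1 + (x + x ^ 2) + (x + x ^ 2) ^ 2 / 2) - 1
      = x ^ 2 * (1 - x - x ^ 2 - x ^ 3) / 2 := by ring
    have : 0 ≤ x ^ 2 * ((1 - x - x ^ 2 - x ^ 3) / 2) := by
      apply mul_nonneg (by positivity)
      nlinarith [mul_nonneg h0 h0, pow_nonneg h0 3]
    nlinarith
  exact this.trans (mul_le_mul_of_nonneg_left h (by linarith))

lemma gaussian_sq_exp (v : NNReal) (t : ℝ) (ht : 0 ≤ t) (htv : t * v ≤ 1 / 8) :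
    Integrable (fun x : ℝ => Real.exp (t * x ^ 2)) (gaussianReal 0 v) ∧
    ∫ x, Real.exp (t * x ^ 2) ∂(gaussianReal 0 v) ≤ Real.exp (t * v + 2 * (t * v) ^ 2) := by
  by_cases hv : v = 0
  · subst hv
    simp [gaussianReal_zero_var, integrable_dirac]
  have hv0 : (0 : ℝ) < v := by positivity
  have key : ∀ x : ℝ, gaussianPDFReal 0 v x * Real.exp (t * x ^ 2) =
      (√(2 * Real.pi * v))⁻¹ * Real.exp (-(1 / (2 * v) - t) * x ^ 2) := by
    intro x
    rw [gaussianPDFReal, mul_assoc, ← Real.exp_add]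
    congr 2
    field_simp
    ring
  have hb : 0 < 1 / (2 * (v : ℝ)) - t := by
    rw [sub_pos, lt_div_iff₀ (by positivity)]; nlinarith
  constructor
  · rw [gaussianReal_of_var_ne_zero _ hv, integrable_withDensity_iff_integrable_smul'
      (measurable_gaussianPDF _ _) (ae_of_all _ fun _ ↦ gaussianPDF_lt_top)]
    simp only [toReal_gaussianPDF, smul_eq_mul, key]
    exact (integrable_exp_neg_mul_sq hb).const_mul _
  · rw [integral_gaussianReal_eq_integral_smul hv]
    simp only [smul_eq_mul, key]
    rw [integral_const_mul, integral_gaussian, inv_mul_le_iff₀ (by positivity)]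
    apply Real.sqrt_le_left (by positivity) |>.2
    rw [mul_pow, Real.sq_sqrt (by positivity), ← Real.exp_nat_mul, div_le_iff₀ hb]
    have := aux_inv_le_exp (x := 2 * (t * v)) (by positivity) (by linarith)
    have e : ((2 : ℕ) : ℝ) * (t * v + 2 * (t * v) ^ 2) = 2 * (t * v) + (2 * (t * v)) ^ 2 := by
      push_cast; ring
    rw [e]
    have e2 : 2 * Real.pi * v * Real.exp (2 * (t * v) + (2 * (t * v)) ^ 2) * (1 / (2 * v) - t)
      = Real.pi * ((1 - 2 * (t * v)) * Real.exp (2 * (t * v) + (2 * (t * v)) ^ 2)) := by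
      field_simp
    rw [e2]
    nlinarith [Real.pi_pos]

lemma pi_gaussian_linear {ι : Type*} [Fintype ι] (v : NNReal) (r : ι → ℝ) :
    (Measure.pi fun _ : ι => gaussianReal 0 v).map (fun x => ∑ i, r i * x i) =
      gaussianReal 0 ((∑ i, (r i ^ 2).toNNReal) * v) := by
  classical
  set P := Measure.pi fun _ : ι => gaussianReal 0 v
  let f : ι → (ι → ℝ) → ℝ := fun i x => r i * x i
  have hind : iIndepFun f P := 
    iIndepFun_pi (μ := fun _ : ι => gaussianReal 0 v) (X := fun i y => r i * y)
      (fun i => by fun_prop)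
  have hm : ∀ i, Measurable (f i) := fun i => by fun_prop
  have hone : ∀ i, P.map (f i) = gaussianReal 0 ((r i ^ 2).toNNReal * v) := by
    intro i
    have : f i = (fun y => r i * y) ∘ (fun x : ι → ℝ => x i) := rfl
    rw [this, ← Measure.map_map (by fun_prop) (by fun_prop),
      (measurePreserving_eval (fun _ : ι => gaussianReal 0 v) i).map_eq,
      gaussianReal_map_const_mul]
    congr 1
    · simp
    · congr 1
      ext; simp [Real.coe_toNNReal _ (sq_nonneg _)]
  have : ∀ s : Finset ι, P.map (∑ i ∈ s, f i) =
      gaussianReal 0 ((∑ i ∈ s, (r i ^ 2).toNNReal) * v) := by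
    intro s
    induction s using Finset.induction_on with
    | empty =>
      simp only [Finset.sum_empty, zero_mul, gaussianReal_zero_var]
      change P.map (fun _ => (0 : ℝ)) = _
      rw [Measure.map_const]; simp [P]
    | insert a s ha ih =>
      rw [Finset.sum_insert ha, Finset.sum_insert ha, add_comm, add_comm (Real.toNNReal _), add_mul]
      have := gaussianReal_add_gaussianReal_of_indepFun
        (hind.indepFun_finsetSum_of_notMem hm ha) ih (hone a)
      rw [this]; simp
  rw [← this]
  congr 1
  ext x; simp [f]

lemma pi_swap {ι κ : Type*} [Fintype ι] [Fintype κ] (μ : Measure ℝ) [IsProbabilityMeasure μ] :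
    MeasurePreserving (fun (x : ι → κ → ℝ) b i => x i b)
      (Measure.pi fun _ : ι => Measure.pi fun _ : κ => μ)
      (Measure.pi fun _ : κ => Measure.pi fun _ : ι => μ) := by
  refine ⟨by fun_prop, ?_⟩
  have h1 := Measure.infinitePi_map_curry_symm (fun (_ : ι) (_ : κ) => μ)
  have h2 := Measure.infinitePi_map_curry (fun (_ : κ) (_ : ι) => μ)
  have h3 := Measure.infinitePi_map_piCongrLeft (fun (_ : κ × ι) => μ) (Equiv.prodComm ι κ)
  simp only [Measure.infinitePi_eq_pi] at h1 h2 h3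
  rw [← h2, ← h3, ← h1, Measure.map_map (by fun_prop) (by fun_prop),
    Measure.map_map (by fun_prop) (by fun_prop)]
  congr 1

/-- Column bound, by Jensen's inequality over the rows. -/
lemma column_bound {ι κ : Type*} [Fintype ι] [Fintype κ] (v : NNReal) (u : ι → κ → ℝ)
    (l T : ℝ) (hl : 0 ≤ l) (hT : ∑ i, ∑ a, u i a ^ 2 ≤ T) (hlT : l * T * v ≤ 1 / 8) :
    Integrable (fun x : ι → ℝ => Real.exp (l * ∑ a, (∑ i, u i a * x i) ^ 2))
      (Measure.pi fun _ : ι => gaussianReal 0 v) ∧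
    ∫ x, Real.exp (l * ∑ a, (∑ i, u i a * x i) ^ 2) ∂(Measure.pi fun _ : ι => gaussianReal 0 v)
      ≤ Real.exp (l * T * v + 2 * (l * T * v) ^ 2) := by
  set P := Measure.pi fun _ : ι => gaussianReal 0 v
  have hT0 : 0 ≤ T := le_trans (by positivity) hT
  let r : κ → ℝ := fun a => ∑ i, u i a ^ 2
  have hr0 : ∀ a, 0 ≤ r a := fun a => by positivity
  have hrz : ∀ a, r a = 0 → ∀ i, u i a = 0 := by
    intro a ha i
    have := (Finset.sum_eq_zero_iff_of_nonneg (fun i _ => sq_nonneg (u i a))).1 ha i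
      (Finset.mem_univ i)
    exact pow_eq_zero_iff (two_ne_zero) |>.1 this
  set S := ∑ a, r a with hS
  have hST : S ≤ T := by rw [hS, Finset.sum_comm]; exact hT
  have hS0 : 0 ≤ S := by positivity
  have hB : (1 : ℝ) ≤ Real.exp (l * T * v + 2 * (l * T * v) ^ 2) := by
    apply Real.one_le_exp; positivity
  rcases hS0.eq_or_lt with h0 | hSpos
  · have hz : ∀ a, r a = 0 := fun a =>
      (Finset.sum_eq_zero_iff_of_nonneg (fun a _ => hr0 a)).1 h0.symm a (Finset.mem_univ a)
    have hu : ∀ i a, u i a = 0 := fun i a => hrz a (hz a) i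
    simp only [hu]
    simpa [P] using hB
  -- one row
  have hrow : ∀ a, Integrable (fun x : ι → ℝ => Real.exp (l * S / r a * (∑ i, u i a * x i) ^ 2)) P ∧
      ∫ x, Real.exp (l * S / r a * (∑ i, u i a * x i) ^ 2) ∂P
        ≤ Real.exp (l * T * v + 2 * (l * T * v) ^ 2) := by
    intro a
    have hlaw := pi_gaussian_linear v (fun i => u i a)
    have hw : (((∑ i, (u i a ^ 2).toNNReal) * v : NNReal) : ℝ) = r a * v := by
      push_cast
      simp [r, Real.coe_toNNReal _ (sq_nonneg _)]
    have hle : l * S / r a * (r a * v) ≤ l * T * v := by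
      by_cases hra : r a = 0
      · rw [hra]; simp; positivity
      · have : l * S / r a * (r a * v) = l * S * v := by field_simp
        rw [this]; gcongr
    have hge : 0 ≤ l * S / r a * (r a * v) := by have := hr0 a; positivity
    have := gaussian_sq_exp ((∑ i, (u i a ^ 2).toNNReal) * v) (l * S / r a)
      (by have := hr0 a; positivity) (by rw [hw]; linarith)
    rw [hw, ← hlaw] at this
    have hsm : AEStronglyMeasurable (fun x : ℝ => Real.exp (l * S / r a * x ^ 2))
      (P.map (fun x => ∑ i, u i a * x i)) := by
      apply Measurable.aestronglyMeasurable; fun_prop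
    have hmf : AEMeasurable (fun x : ι → ℝ => ∑ i, u i a * x i) P :=
      Measurable.aemeasurable (by fun_prop)
    rw [integrable_map_measure hsm hmf, integral_map hmf hsm] at this
    refine ⟨this.1, this.2.trans ?_⟩
    gcongr
  have hJ : ∀ x : ι → ℝ, Real.exp (l * ∑ a, (∑ i, u i a * x i) ^ 2) ≤
      ∑ a, r a / S * Real.exp (l * S / r a * (∑ i, u i a * x i) ^ 2) := by
    intro x
    have := convexOn_exp.map_sum_le (t := Finset.univ) (w := fun a => r a / S)
      (p := fun a => l * S / r a * (∑ i, u i a * x i) ^ 2)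
      (fun a _ => by have := hr0 a; positivity)
      (by rw [← Finset.sum_div, ← hS, div_self hSpos.ne']) (fun _ _ => Set.mem_univ _)
    simp only [smul_eq_mul] at this
    refine le_trans (le_of_eq ?_) this
    congr 1
    rw [Finset.mul_sum]
    refine Finset.sum_congr rfl fun a _ => ?_
    by_cases hra : r a = 0
    · simp [hrz a hra]
    · field_simp
  have hI : Integrable (fun x : ι → ℝ =>
      ∑ a, r a / S * Real.exp (l * S / r a * (∑ i, u i a * x i) ^ 2)) P :=
    integrable_finsetSum _ fun a _ => (hrow a).1.const_mul _
  have hI0 : Integrable (fun x : ι → ℝ => Real.exp (l * ∑ a, (∑ i, u i a * x i) ^ 2)) P := by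
    refine hI.mono' (Measurable.aestronglyMeasurable (by fun_prop)) (ae_of_all _ fun x => ?_)
    rw [Real.norm_eq_abs, abs_of_pos (Real.exp_pos _)]
    exact hJ x
  refine ⟨hI0, (integral_mono hI0 hI hJ).trans ?_⟩
  rw [integral_finsetSum _ fun a _ => (hrow a).1.const_mul _]
  simp only [integral_const_mul]
  calc _ ≤ ∑ a, r a / S * Real.exp (l * T * v + 2 * (l * T * v) ^ 2) := by
        refine Finset.sum_le_sum fun a _ => mul_le_mul_of_nonneg_left (hrow a).2 ?_
        have := hr0 a; positivity
    _ = _ := by rw [← Finset.sum_mul, ← Finset.sum_div, ← hS, div_self hSpos.ne', one_mul]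

lemma cond_bound {ι κ : Type*} [Fintype ι] [Fintype κ] (v : NNReal) (u : ι → κ → ℝ)
    (l T : ℝ) (hl : 0 ≤ l) (hT : ∑ i, ∑ a, u i a ^ 2 ≤ T) (hlT : l * T * v ≤ 1 / 8) :
    Integrable (fun x : ι → κ → ℝ => Real.exp (l * ∑ a, ∑ b, (∑ i, u i a * x i b) ^ 2))
      (Measure.pi fun _ : ι => Measure.pi fun _ : κ => gaussianReal 0 v) ∧
    ∫ x, Real.exp (l * ∑ a, ∑ b, (∑ i, u i a * x i b) ^ 2)
      ∂(Measure.pi fun _ : ι => Measure.pi fun _ : κ => gaussianReal 0 v)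
      ≤ Real.exp (Fintype.card κ * (l * T * v + 2 * (l * T * v) ^ 2)) := by
  have hmp := pi_swap (ι := ι) (κ := κ) (gaussianReal 0 v)
  obtain ⟨hi, hb⟩ := column_bound v u l T hl hT hlT
  let F : (κ → ι → ℝ) → ℝ := fun y => ∏ b, Real.exp (l * ∑ a, (∑ i, u i a * y b i) ^ 2)
  have hF : (fun x : ι → κ → ℝ => Real.exp (l * ∑ a, ∑ b, (∑ i, u i a * x i b) ^ 2)) =
      fun x => F (fun b i => x i b) := by
    ext x
    simp only [F]
    rw [← Real.exp_sum, ← Finset.mul_sum, Finset.sum_comm]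
  have hFm : Measurable F := by fun_prop
  have hFI : Integrable F (Measure.pi fun _ : κ => Measure.pi fun _ : ι => gaussianReal 0 v) :=
    Integrable.fintype_prod (fun _ => hi)
  rw [hF]
  refine ⟨hmp.integrable_comp_of_integrable hFI, ?_⟩
  have e : ∫ x, F (fun b i => x i b)
      ∂(Measure.pi fun _ : ι => Measure.pi fun _ : κ => gaussianReal 0 v) =
      ∫ y, F y ∂(Measure.pi fun _ : κ => Measure.pi fun _ : ι => gaussianReal 0 v) := by
    rw [← hmp.map_eq, integral_map hmp.measurable.aemeasurable hFm.aestronglyMeasurable]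
  rw [e]
  simp only [F]
  rw [integral_fintype_prod_eq_pow
    (fun z : ι → ℝ => Real.exp (l * ∑ a, (∑ i, u i a * z i) ^ 2)), Real.exp_nat_mul]
  exact pow_le_pow_left₀ (integral_nonneg fun _ => (Real.exp_pos _).le) hb _

lemma trace_bound {ι κ : Type*} [Fintype ι] [Fintype κ] (v : NNReal)
    (l : ℝ) (hl : 0 ≤ l) (hlT : l * v ≤ 1 / 8) :
    Integrable (fun x : ι → κ → ℝ => Real.exp (l * ∑ i, ∑ a, x i a ^ 2))
      (Measure.pi fun _ : ι => Measure.pi fun _ : κ => gaussianReal 0 v) ∧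
    ∫ x, Real.exp (l * ∑ i, ∑ a, x i a ^ 2)
      ∂(Measure.pi fun _ : ι => Measure.pi fun _ : κ => gaussianReal 0 v)
      ≤ Real.exp (Fintype.card ι * (Fintype.card κ * (l * v + 2 * (l * v) ^ 2))) := by
  obtain ⟨hi, hb⟩ := gaussian_sq_exp v l hl hlT
  have e : ∀ x : ι → κ → ℝ, Real.exp (l * ∑ i, ∑ a, x i a ^ 2) =
      ∏ i, ∏ a, Real.exp (l * x i a ^ 2) := by
    intro x
    simp only [← Real.exp_sum, ← Finset.mul_sum]
  simp only [e]
  refine ⟨Integrable.fintype_prod (f := fun (_ : ι) (z : κ → ℝ) => ∏ a, Real.exp (l * z a ^ 2))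
    fun _ => Integrable.fintype_prod (f := fun (_ : κ) (z : ℝ) => Real.exp (l * z ^ 2))
      fun _ => hi, ?_⟩
  rw [integral_fintype_prod_eq_pow (fun z : κ → ℝ => ∏ a, Real.exp (l * z a ^ 2)),
    integral_fintype_prod_eq_pow (fun z : ℝ => Real.exp (l * z ^ 2)),
    Real.exp_nat_mul, Real.exp_nat_mul]
  have h0 : 0 ≤ ∫ x, Real.exp (l * x ^ 2) ∂(gaussianReal 0 v) :=
    integral_nonneg fun _ => (Real.exp_pos _).le
  gcongr

lemma chernoff {Ω : Type*} [MeasurableSpace Ω] (P : Measure Ω) [IsProbabilityMeasure P]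
    (X : Ω → ℝ) (l A B C : ℝ) (hl : 0 ≤ l) (hi : Integrable (fun x => Real.exp (l * X x)) P)
    (hb : ∫ x, Real.exp (l * X x) ∂P ≤ Real.exp B) (hC : B - l * A ≤ C) :
    P {x | A < X x} ≤ ENNReal.ofReal (Real.exp C) := by
  have h := measure_ge_le_exp_mul_mgf (μ := P) (X := X) A hl hi
  have h2 : P.real {x | A ≤ X x} ≤ Real.exp C := by
    refine h.trans ?_
    calc _ ≤ Real.exp (-l * A) * Real.exp B := by
          gcongr; exact hb
      _ = Real.exp (B - l * A) := by rw [← Real.exp_add]; ring_nf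
      _ ≤ _ := by gcongr
  calc P {x | A < X x} ≤ P {x | A ≤ X x} := measure_mono fun x hx =>
        (show A ≤ X x from le_of_lt (show A < X x from hx))
    _ = ENNReal.ofReal (P.real {x | A ≤ X x}) := by simp
    _ ≤ _ := ENNReal.ofReal_le_ofReal h2


/-- **Cross-term concentration.** For every `ε > 0` and `c₀ > 0` there is `c > 0` such
that for all large `d`: if `n ≥ c₀ d² / log d`, then with probability at least
`1 - e^{-c d}`, the Frobenius norm of `U Vᵀ` is at most `(1+ε)√n`. -/
theorem cross_term_frobenius_bound (ε c₀ : ℝ) (hε : 0 < ε) (hc₀ : 0 < c₀) :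
    ∃ c : ℝ, 0 < c ∧ ∃ d₀ : ℕ, ∀ d : ℕ, d₀ ≤ d → ∀ n : ℕ,
      c₀ * (d : ℝ) ^ 2 / Real.log d ≤ (n : ℝ) →
      ENNReal.ofReal (1 - Real.exp (-c * d)) ≤
        gaussianModel d n
          {p | Real.sqrt (∑ a : Fin d, ∑ b : Fin d,
              (∑ i : Fin n, p.1 i a * p.2 i b) ^ 2) ≤ (1 + ε) * Real.sqrt n} := by
  have hs0 : ∃ s : ℝ, 0 < s ∧ s ≤ ε / 4 ∧ s ≤ 1 / 8 :=
    ⟨min (ε / 4) (1 / 8), by positivity, min_le_left _ _, min_le_right _ _⟩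
  obtain ⟨s, hs, hsε, hs8⟩ := hs0
  set c := s * ε / 2 with hc
  have hcpos : 0 < c := by positivity
  refine ⟨c / 2, by positivity, ⌈2 / c⌉₊ + 1, fun d hd n _ => ?_⟩
  have hdR : 2 / c ≤ d := by
    refine (Nat.le_ceil _).trans ?_
    exact_mod_cast (Nat.le_succ _).trans hd
  have hd1 : 0 < d := by omega
  have hd0 : (0 : ℝ) < d := by exact_mod_cast hd1
  have hprob : IsProbabilityMeasure (stdGaussianVec d) := by
    unfold stdGaussianVec; infer_instance
  have hprob2 : IsProbabilityMeasure (gaussianModel d n) := by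
    unfold gaussianModel; infer_instance
  rcases Nat.eq_zero_or_pos n with hn | hn
  · subst hn
    simp only [Finset.univ_eq_empty, Finset.sum_empty]
    simp only [ne_eq, OfNat.ofNat_ne_zero, not_false_eq_true, zero_pow, Finset.sum_const_zero,
      Real.sqrt_zero, Nat.cast_zero, mul_zero, le_refl, Set.ofPred_true, measure_univ]
    rw [ENNReal.ofReal_le_one]
    linarith [Real.exp_pos (-(c / 2) * d)]
  have hn1 : (1 : ℝ) ≤ n := by exact_mod_cast hn
  have hn0 : (0 : ℝ) < n := by linarith
  have hv : (((d : NNReal)⁻¹ : NNReal) : ℝ) = (d : ℝ)⁻¹ := by simp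
  set Q : Measure (Fin n → Fin d → ℝ) := Measure.pi fun _ : Fin n => stdGaussianVec d with hQ
  let T : (Fin n → Fin d → ℝ) → ℝ := fun u => ∑ i, ∑ a, u i a ^ 2
  let F : (Fin n → Fin d → ℝ) → (Fin n → Fin d → ℝ) → ℝ := fun u x =>
    ∑ a, ∑ b, (∑ i, u i a * x i b) ^ 2
  have hTm : Measurable T := by fun_prop
  have hFm : Measurable (fun p : (Fin n → Fin d → ℝ) × (Fin n → Fin d → ℝ) => F p.1 p.2) := by
    fun_prop
  -- first bad event
  have hb1 : Q {u | (1 + ε) * n < T u} ≤ ENNReal.ofReal (Real.exp (-c * d)) := by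
    have hlv : s * d * (((d : NNReal)⁻¹ : NNReal) : ℝ) = s := by rw [hv]; field_simp
    obtain ⟨hi, hb⟩ := trace_bound (ι := Fin n) (κ := Fin d) (d : NNReal)⁻¹ (s * d)
      (by positivity) (by rw [hlv]; exact hs8)
    rw [hlv, Fintype.card_fin, Fintype.card_fin] at hb
    refine chernoff Q T (s * d) ((1 + ε) * n) _ _ (by positivity) hi hb ?_
    have e : (n : ℝ) * (d * (s + 2 * s ^ 2)) - s * d * ((1 + ε) * n) =
      (d * s) * (n * (2 * s - ε)) := by ring
    have e2 : -c * d = (d * s) * (-(ε / 2)) := by rw [hc]; ring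
    rw [e, e2]
    apply mul_le_mul_of_nonneg_left _ (by positivity)
    nlinarith
  -- second bad event, conditionally on the first matrix
  have hb2 : ∀ u, T u ≤ (1 + ε) * n →
      Q {x | (1 + ε) ^ 2 * n < F u x} ≤ ENNReal.ofReal (Real.exp (-c * d)) := by
    intro u hu
    set l : ℝ := s * d / (n * (1 + ε)) with hl
    have hl0 : 0 ≤ l := by positivity
    have hlv : l * ((1 + ε) * n) * (((d : NNReal)⁻¹ : NNReal) : ℝ) = s := by
      rw [hv, hl]; field_simp
    obtain ⟨hi, hb⟩ := cond_bound (d : NNReal)⁻¹ u l ((1 + ε) * n) hl0 hu (by rw [hlv]; exact hs8)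
    rw [hlv, Fintype.card_fin] at hb
    refine chernoff Q (F u) l ((1 + ε) ^ 2 * n) _ _ hl0 hi hb ?_
    have e0 : l * ((1 + ε) ^ 2 * n) = s * d * (1 + ε) := by rw [hl]; field_simp
    have e2 : -c * d = (d * s) * (-(ε / 2)) := by rw [hc]; ring
    rw [e0, e2, show (d : ℝ) * (s + 2 * s ^ 2) - s * d * (1 + ε) = (d * s) * (2 * s - ε) by ring]
    apply mul_le_mul_of_nonneg_left _ (by positivity)
    linarith
  -- combine
  set G : Set ((Fin n → Fin d → ℝ) × (Fin n → Fin d → ℝ)) :=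
    {p | Real.sqrt (∑ a : Fin d, ∑ b : Fin d,
              (∑ i : Fin n, p.1 i a * p.2 i b) ^ 2) ≤ (1 + ε) * Real.sqrt n} with hG
  have hGm : MeasurableSet G := measurableSet_le (by fun_prop) (by fun_prop)
  set B1 : Set ((Fin n → Fin d → ℝ) × (Fin n → Fin d → ℝ)) := {u | (1 + ε) * n < T u} ×ˢ Set.univ
  set B2 : Set ((Fin n → Fin d → ℝ) × (Fin n → Fin d → ℝ)) :=
    {p | T p.1 ≤ (1 + ε) * n ∧ (1 + ε) ^ 2 * n < F p.1 p.2}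
  have hB2m : MeasurableSet B2 := by
    have h1 : MeasurableSet {p : (Fin n → Fin d → ℝ) × (Fin n → Fin d → ℝ) |
        T p.1 ≤ (1 + ε) * n} := measurableSet_le (hTm.comp measurable_fst) measurable_const
    have h2 : MeasurableSet {p : (Fin n → Fin d → ℝ) × (Fin n → Fin d → ℝ) |
        (1 + ε) ^ 2 * n < F p.1 p.2} := measurableSet_lt measurable_const hFm
    have h3 : B2 = {p | T p.1 ≤ (1 + ε) * n} ∩ {p | (1 + ε) ^ 2 * n < F p.1 p.2} := by
      ext p; simp [B2]
    rw [h3]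
    exact h1.inter h2
  have hsub : Gᶜ ⊆ B1 ∪ B2 := by
    intro p hp
    by_cases h1 : (1 + ε) * n < T p.1
    · left; exact ⟨h1, Set.mem_univ _⟩
    · right
      refine ⟨not_lt.1 h1, ?_⟩
      by_contra h2
      apply hp
      change Real.sqrt (F p.1 p.2) ≤ _
      refine Real.sqrt_le_iff.2 ⟨by positivity, ?_⟩
      rw [mul_pow, Real.sq_sqrt hn0.le]
      exact not_lt.1 h2
  have hm1 : gaussianModel d n B1 ≤ ENNReal.ofReal (Real.exp (-c * d)) := by
    change (Q.prod Q) _ ≤ _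
    rw [Measure.prod_prod, measure_univ, mul_one]
    exact hb1
  have hm2 : gaussianModel d n B2 ≤ ENNReal.ofReal (Real.exp (-c * d)) := by
    change (Q.prod Q) _ ≤ _
    rw [Measure.prod_apply hB2m]
    calc _ ≤ ∫⁻ _, ENNReal.ofReal (Real.exp (-c * d)) ∂Q := by
          refine lintegral_mono fun u => ?_
          by_cases hu : T u ≤ (1 + ε) * n
          · exact (measure_mono fun x hx => hx.2).trans (hb2 u hu)
          · have : Prod.mk u ⁻¹' B2 = ∅ := by
              ext x; simp [B2, hu]
            simp [this]
      _ = _ := by simp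
  have hexp : 2 * Real.exp (-c * d) ≤ Real.exp (-(c / 2) * d) := by
    have h1 : 1 ≤ c / 2 * d := by
      rw [div_le_iff₀ hcpos] at hdR; linarith
    have h2 : (2 : ℝ) ≤ Real.exp (c / 2 * d) := by
      have := Real.add_one_le_exp (c / 2 * d); linarith
    calc _ ≤ Real.exp (c / 2 * d) * Real.exp (-c * d) := by gcongr
      _ = _ := by rw [← Real.exp_add]; ring_nf
  have hcompl : gaussianModel d n Gᶜ ≤ ENNReal.ofReal (Real.exp (-(c / 2) * d)) := by
    calc _ ≤ gaussianModel d n B1 + gaussianModel d n B2 :=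
          (measure_mono hsub).trans (measure_union_le _ _)
      _ ≤ ENNReal.ofReal (Real.exp (-c * d)) + ENNReal.ofReal (Real.exp (-c * d)) :=
          add_le_add hm1 hm2
      _ = ENNReal.ofReal (2 * Real.exp (-c * d)) := by
          rw [← ENNReal.ofReal_add (by positivity) (by positivity), two_mul]
      _ ≤ _ := ENNReal.ofReal_le_ofReal hexp
  have hGc : gaussianModel d n G = 1 - gaussianModel d n Gᶜ := by
    rw [← prob_compl_eq_one_sub hGm.compl, compl_compl]
  rw [hGc, ENNReal.ofReal_sub _ (Real.exp_pos _).le, ENNReal.ofReal_one]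
  exact tsub_le_tsub_left hcompl 1

end
end

section
/- Let n ≥ 3 and d ≥ 2, and let (θ, ξ) ∈ ℝ × ℝ^{n−1} be given by the first column of the score matrix, (θ, ξ^⊤)^⊤ = S e_1. Let a ~ N(0,1), g ~ N(0, I_{n−1}), ρ₁, ρ₂ ~ χ(d)/√d, ρ₃ ~ χ(n−1)/√n, ρ₄ ~ χ(d−1)/√d, ρ₅ ~ χ(n−2)/√n, all mutually independent. Set s = ρ₁ρ₂ + √(n/d²)·ρ₃·a and r = [ (a s/√n + ρ₃ ρ₄²)²/d + s² ρ₅²/d + (n/d²) ρ₃² ρ₄² ρ₅² ]^{1/2}. Then (θ, ξ) has the same distribution as ρ₁·( ρ₂ s, (r/(‖g‖/√n))·g ), i.e. θ =_d ρ₁ρ₂ s jointly with ξ =_d ρ₁ r √n g/‖g‖. -/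
open MeasureTheory ProbabilityTheory Matrix

noncomputable section

/-- The correlation matrix memory `W^× = U Vᵀ`. -/
def Wcross {d n : ℕ} (u v : Fin n → Fin d → ℝ) : Matrix (Fin d) (Fin d) ℝ :=
  Matrix.of fun a b => ∑ i, u i a * v i b

/-- The score `s_{j,i} = u_j^⊤ W^× v_i = (U^⊤U V^⊤V)_{j,i}`. -/
def scoreX {d n : ℕ} (u v : Fin n → Fin d → ℝ) (j i : Fin n) : ℝ :=
  u j ⬝ᵥ (Wcross u v).mulVec (v i)

/-- The chi distribution with `k` degrees of freedom: the law of the Euclidean norm of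
a standard Gaussian vector in `ℝ^k`. -/
def chiDist (k : ℕ) : Measure ℝ :=
  (Measure.pi fun _ : Fin k => gaussianReal 0 1).map fun x =>
    Real.sqrt (∑ t, x t ^ 2)

/-- The chi distribution with `k` degrees of freedom, scaled by `1/c`. -/
def scaledChi (k : ℕ) (c : ℝ) : Measure ℝ := (chiDist k).map (· / c)

/-- Standard Gaussian vector. -/
def gam (k : ℕ) : Measure (Fin k → ℝ) := Measure.pi fun _ : Fin k => gaussianReal 0 1

/-- Standard Gaussian matrix. -/
def Gam (m d : ℕ) : Measure (Fin m → Fin d → ℝ) := Measure.pi fun _ : Fin m => gam d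

instance (k : ℕ) : IsProbabilityMeasure (gam k) := by unfold gam; infer_instance
instance (m d : ℕ) : IsProbabilityMeasure (Gam m d) := by unfold Gam; infer_instance

instance (k : ℕ) : SFinite (gam k) := inferInstance
instance (m d : ℕ) : SFinite (Gam m d) := inferInstance
instance (m d : ℕ) : SFinite ((gam d).prod (Gam m d)) := inferInstance

/-- Euclidean norm -/
def nrm {k : ℕ} (x : Fin k → ℝ) : ℝ := Real.sqrt (∑ t, x t ^ 2)

@[fun_prop]
lemma measurable_nrm {k : ℕ} : Measurable (nrm (k := k)) := by unfold nrm; fun_prop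

@[fun_prop]
lemma measurable_dot {α : Type*} [MeasurableSpace α] {k : ℕ} {f g : α → Fin k → ℝ}
    (hf : Measurable f) (hg : Measurable g) : Measurable fun x => f x ⬝ᵥ g x := by
  unfold dotProduct; fun_prop

@[fun_prop]
lemma measurable_mulVec_const {m k : ℕ} (Q : Matrix (Fin m) (Fin k) ℝ) :
    Measurable (fun x => Q *ᵥ x) := by
  unfold Matrix.mulVec; fun_prop

lemma nrm_nonneg {k : ℕ} (x : Fin k → ℝ) : 0 ≤ nrm x := Real.sqrt_nonneg _

lemma nrm_sq {k : ℕ} (x : Fin k → ℝ) : nrm x ^ 2 = x ⬝ᵥ x := by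
  unfold nrm
  rw [Real.sq_sqrt (Finset.sum_nonneg fun _ _ => sq_nonneg _)]
  simp [dotProduct, sq]

lemma nrm_eq {k : ℕ} (x : Fin k → ℝ) : nrm x = Real.sqrt (x ⬝ᵥ x) := by
  rw [← nrm_sq, Real.sqrt_sq (nrm_nonneg x)]

lemma map_skew {α β β' γ : Type*} [MeasurableSpace α] [MeasurableSpace β] [MeasurableSpace β']
    [MeasurableSpace γ] {μ : Measure α} {ν : Measure β} {ν' : Measure β'} [SFinite μ] [SFinite ν]
    [SFinite ν'] {f : α × β → γ} {f' : α × β' → γ} (hf : Measurable f) (hf' : Measurable f')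
    (h : ∀ x, ν.map (fun y => f (x, y)) = ν'.map (fun y => f' (x, y))) :
    (μ.prod ν).map f = (μ.prod ν').map f' := by
  ext s hs
  rw [Measure.map_apply hf hs, Measure.map_apply hf' hs, Measure.prod_apply (hf hs),
    Measure.prod_apply (hf' hs)]
  refine lintegral_congr fun x => ?_
  have := congrArg (fun m => m s) (h x)
  beta_reduce at this
  rw [Measure.map_apply (by fun_prop) hs, Measure.map_apply (by fun_prop) hs] at this
  exact this

lemma charFunDual_gam {k : ℕ} (L : StrongDual ℝ (Fin k → ℝ)) :
    charFunDual (gam k) L = Complex.exp (-((∑ i, (L (Pi.single i 1)) ^ 2 : ℝ) : ℂ) / 2) := by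
  unfold gam
  rw [charFunDual_pi]
  have : ∀ i, charFunDual (gaussianReal 0 1) (L.comp (.single ℝ (fun _ => ℝ) i))
      = Complex.exp (-(((L (Pi.single i 1)) ^ 2 : ℝ) : ℂ) / 2) := by
    intro i
    rw [charFunDual_eq_charFun_map_one, ← charFunDual_eq_charFun_map_one]
    rw [IsGaussian.charFunDual_eq]
    have h1 : ∀ x : ℝ, (L.comp (.single ℝ (fun _ => ℝ) i)) x = L (Pi.single i 1) * x := by
      intro x
      have : (Pi.single i x : Fin k → ℝ) = x • Pi.single i 1 := by
        rw [← Pi.single_smul]; simp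
      simp [this, mul_comm]
    have h2 : (⇑(L.comp (.single ℝ (fun _ => ℝ) i)) : ℝ → ℝ) = fun x => L (Pi.single i 1) * x :=
      funext h1
    rw [integral_complex_ofReal]
    rw [h2, variance_const_mul, integral_const_mul]
    simp [neg_div]
  simp_rw [this, ← Complex.exp_sum]
  congr 1
  push_cast
  rw [neg_div, Finset.sum_div, ← Finset.sum_neg_distrib]
  simp [neg_div]

lemma gam_rot {k : ℕ} (Q : Matrix (Fin k) (Fin k) ℝ) (hQ : Q * Qᵀ = 1) :
    MeasurePreserving (fun x => Q *ᵥ x) (gam k) (gam k) := by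
  refine ⟨by fun_prop, ?_⟩
  have hm : Measurable fun x => Q *ᵥ x := by fun_prop
  have : IsProbabilityMeasure ((gam k).map fun x => Q *ᵥ x) :=
    Measure.isProbabilityMeasure_map hm.aemeasurable
  apply Measure.ext_of_charFunDual
  ext L
  let A : (Fin k → ℝ) →L[ℝ] (Fin k → ℝ) := LinearMap.toContinuousLinearMap (Matrix.mulVecLin Q)
  have hA : (fun x => Q *ᵥ x) = ⇑A := rfl
  rw [hA, charFunDual_map, charFunDual_gam, charFunDual_gam]
  congr 4
  have hL : ∀ x, L x = (fun i => L (Pi.single i 1)) ⬝ᵥ x := by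
    intro x
    conv_lhs => rw [pi_eq_sum_univ' x]
    simp [dotProduct, mul_comm]
  have h1 : ∀ i, (L.comp A) (Pi.single i 1) = ((fun i => L (Pi.single i 1)) ᵥ* Q) i := by
    intro i
    rw [ContinuousLinearMap.comp_apply, hL]
    change _ ⬝ᵥ (Q *ᵥ Pi.single i 1) = _
    rw [Matrix.dotProduct_mulVec, dotProduct_single_one]
  simp_rw [h1]
  set t := (fun i => L (Pi.single i 1))
  have : (t ᵥ* Q) ⬝ᵥ (t ᵥ* Q) = t ⬝ᵥ t := by
    rw [← Matrix.dotProduct_mulVec, ← Matrix.mulVec_transpose, Matrix.mulVec_mulVec, hQ, Matrix.one_mulVec]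
  simpa [dotProduct, sq] using this

lemma Gam_swap (m d : ℕ) :
    MeasurePreserving (fun (G : Fin m → Fin d → ℝ) a i => G i a) (Gam m d) (Gam d m) := by
  have hm : Measurable (fun (G : Fin m → Fin d → ℝ) a i => G i a) := by fun_prop
  refine ⟨hm, ?_⟩
  have : IsProbabilityMeasure ((Gam m d).map (fun (G : Fin m → Fin d → ℝ) a i => G i a)) :=
    Measure.isProbabilityMeasure_map hm.aemeasurable
  apply Measure.ext_of_charFunDual
  ext L
  let A0 : (Fin m → Fin d → ℝ) →ₗ[ℝ] (Fin d → Fin m → ℝ) :=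
    { toFun := fun G a i => G i a
      map_add' := fun _ _ => rfl
      map_smul' := fun _ _ => rfl }
  let A := LinearMap.toContinuousLinearMap A0
  have hA : (fun (G : Fin m → Fin d → ℝ) a i => G i a) = ⇑A := rfl
  rw [hA, charFunDual_map]
  unfold Gam
  rw [charFunDual_pi, charFunDual_pi]
  simp_rw [charFunDual_gam, ← Complex.exp_sum]
  congr 1
  rw [← Finset.sum_div, ← Finset.sum_div, Finset.sum_neg_distrib, Finset.sum_neg_distrib,
    ← Complex.ofReal_sum, ← Complex.ofReal_sum, Finset.sum_comm]
  congr 4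
  ext a
  congr 1
  ext i
  congr 1
  simp only [ContinuousLinearMap.comp_apply]
  congr 1
  ext b j
  change (Pi.single i (Pi.single a 1) : Fin m → Fin d → ℝ) j b
    = (Pi.single a (Pi.single i 1) : Fin d → Fin m → ℝ) b j
  by_cases h1 : j = i <;> by_cases h2 : b = a <;> simp [h1, h2]

lemma Gam_rot {m : ℕ} (d : ℕ) (Q : Matrix (Fin m) (Fin m) ℝ) (hQ : Q * Qᵀ = 1) :
    MeasurePreserving (fun (G : Fin m → Fin d → ℝ) i a => (Q *ᵥ fun k => G k a) i)
      (Gam m d) (Gam m d) := by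
  have h1 := Gam_swap m d
  have h2 : MeasurePreserving (fun (G : Fin d → Fin m → ℝ) a => Q *ᵥ G a) (Gam d m) (Gam d m) :=
    measurePreserving_pi (fun _ => gam m) (fun _ => gam m) (fun _ => gam_rot Q hQ)
  exact (Gam_swap d m).comp (h2.comp h1)

lemma exists_rot {k : ℕ} (x y : Fin k → ℝ) (h : x ⬝ᵥ x = y ⬝ᵥ y) :
    ∃ Q : Matrix (Fin k) (Fin k) ℝ, Q * Qᵀ = 1 ∧ Qᵀ * Q = 1 ∧ Q *ᵥ x = y := by
  by_cases hxy : x = y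
  · exact ⟨1, by simp, by simp, by simp [hxy]⟩
  set w := x - y with hw
  have hw0 : w ⬝ᵥ w ≠ 0 := by
    intro h0
    rw [dotProduct_self_eq_zero] at h0
    exact hxy (sub_eq_zero.mp h0)
  have hwx : w ⬝ᵥ w = 2 * (w ⬝ᵥ x) := by
    simp only [hw, sub_dotProduct, dotProduct_sub]
    rw [dotProduct_comm y x, h]; ring_nf
  set Q : Matrix (Fin k) (Fin k) ℝ := 1 - (2 / (w ⬝ᵥ w)) • Matrix.vecMulVec w w with hQ
  have hT : Qᵀ = Q := by
    rw [hQ, Matrix.transpose_sub, Matrix.transpose_smul, Matrix.transpose_vecMulVec]; simp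
  have hQQ : Q * Q = 1 := by
    have h2 : Matrix.vecMulVec w w * Matrix.vecMulVec w w = (w ⬝ᵥ w) • Matrix.vecMulVec w w := by
      rw [Matrix.vecMulVec_mul_vecMulVec]
      ext i j; simp [Matrix.vecMulVec_apply]; ring
    rw [hQ, sub_mul, mul_sub, mul_sub]
    simp only [one_mul, mul_one, Matrix.smul_mul, Matrix.mul_smul, h2, smul_smul]
    ext i j
    simp
    field_simp
    ring
  refine ⟨Q, by rw [hT, hQQ], by rw [hT, hQQ], ?_⟩
  rw [hQ, Matrix.sub_mulVec, Matrix.smul_mulVec, Matrix.one_mulVec, Matrix.vecMulVec_mulVec]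
  ext i
  have : x i - y i = w i := rfl
  simp
  rw [hwx] at hw0 ⊢
  field_simp
  have h3 : w ⬝ᵥ x ≠ 0 := by intro h; simp [h] at hw0
  field_simp
  linarith

lemma pi_split {E : Type} [MeasurableSpace E] (ν : Measure E) [IsProbabilityMeasure ν] (k : ℕ) :
    MeasurePreserving (fun f : Fin (k + 1) → E => (f 0, fun j : Fin k => f j.succ))
      (Measure.pi fun _ => ν) (ν.prod (Measure.pi fun _ => ν)) := by
  have := measurePreserving_piFinSuccAbove (fun _ : Fin (k + 1) => ν) 0
  exact this

lemma gam_split (k : ℕ) :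
    MeasurePreserving (fun f : Fin (k + 1) → ℝ => (f 0, fun j : Fin k => f j.succ))
      (gam (k + 1)) ((gaussianReal 0 1).prod (gam k)) := pi_split _ k

lemma Gam_split (k d : ℕ) :
    MeasurePreserving (fun f : Fin (k + 1) → Fin d → ℝ => (f 0, fun j : Fin k => f j.succ))
      (Gam (k + 1) d) ((gam d).prod (Gam k d)) := pi_split _ k

lemma exists_rot_e0 {k : ℕ} (x : Fin (k + 1) → ℝ) :
    ∃ Q : Matrix (Fin (k + 1)) (Fin (k + 1)) ℝ, Q * Qᵀ = 1 ∧ Qᵀ * Q = 1 ∧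
      Q *ᵥ x = Pi.single 0 (nrm x) := by
  apply exists_rot
  rw [← nrm_sq, dotProduct_single]
  simp [sq]

lemma rot_dot {k : ℕ} {Q : Matrix (Fin k) (Fin k) ℝ} (h : Qᵀ * Q = 1) (x y : Fin k → ℝ) :
    (Q *ᵥ x) ⬝ᵥ (Q *ᵥ y) = x ⬝ᵥ y := by
  rw [Matrix.dotProduct_mulVec, Matrix.vecMul_mulVec, h, Matrix.vecMul_one]

lemma dot_pair_law {k : ℕ} (u : Fin (k + 1) → ℝ) :
    (gam (k + 1)).map (fun z => (u ⬝ᵥ z, z ⬝ᵥ z)) =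
      ((gaussianReal 0 1).prod (gam k)).map
        (fun p => (nrm u * p.1, p.1 ^ 2 + nrm p.2 ^ 2)) := by
  obtain ⟨Q, h1, h2, h3⟩ := exists_rot_e0 u
  have hr := gam_rot Q h1
  have hs := gam_split k
  rw [← hs.map_eq, Measure.map_map (by fun_prop) (by fun_prop)]
  conv_rhs => rw [← hr.map_eq]
  rw [Measure.map_map (by fun_prop) (by fun_prop)]
  congr 1
  ext z
  · simp only [Function.comp]
    rw [← rot_dot h2, h3, single_dotProduct]
  · simp only [Function.comp]
    rw [← rot_dot h2 z z, nrm_sq]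
    simp [dotProduct, Fin.sum_univ_succ, sq]

lemma dot_law {k : ℕ} (u : Fin (k + 1) → ℝ) :
    (gam (k + 1)).map (fun z => z ⬝ᵥ u) = (gaussianReal 0 1).map (fun t => nrm u * t) := by
  have h := congrArg (Measure.map Prod.fst) (dot_pair_law u)
  rw [Measure.map_map (by fun_prop) (by fun_prop), Measure.map_map (by fun_prop) (by fun_prop)] at h
  have e1 : (Prod.fst ∘ fun z => (u ⬝ᵥ z, z ⬝ᵥ z)) = fun z : Fin (k + 1) → ℝ => z ⬝ᵥ u := by
    ext z; simp [dotProduct_comm]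
  have e2 : (Prod.fst ∘ fun p : ℝ × (Fin k → ℝ) => (nrm u * p.1, p.1 ^ 2 + nrm p.2 ^ 2))
      = (fun t => nrm u * t) ∘ Prod.fst := by
    ext z; simp
  rw [e1, e2, ← Measure.map_map (by fun_prop) (by fun_prop)] at h
  rw [h]
  congr 1
  exact Measure.map_fst_prod.trans (by simp)

lemma dots_law {k m : ℕ} (u : Fin (k + 1) → ℝ) :
    (Gam m (k + 1)).map (fun V i => V i ⬝ᵥ u) = (gam m).map (fun h i => nrm u * h i) := by
  have i1 : IsProbabilityMeasure ((gam (k + 1)).map (fun z => z ⬝ᵥ u)) :=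
    Measure.isProbabilityMeasure_map (by fun_prop)
  have i2 : IsProbabilityMeasure ((gaussianReal 0 1).map (fun t => nrm u * t)) :=
    Measure.isProbabilityMeasure_map (by fun_prop)
  have a1 := Measure.pi_map_pi (ι := Fin m) (μ := fun _ => gam (k + 1))
    (f := fun _ z => z ⬝ᵥ u) (fun i => by fun_prop)
  have a2 := Measure.pi_map_pi (ι := Fin m) (μ := fun _ => gaussianReal 0 1)
    (f := fun _ t => nrm u * t) (fun i => by fun_prop)
  unfold Gam
  conv_rhs => unfold gam
  rw [a1, a2, dot_law]

lemma nrm_rot {k : ℕ} {Q : Matrix (Fin k) (Fin k) ℝ} (h : Qᵀ * Q = 1) (x : Fin k → ℝ) :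
    nrm (Q *ᵥ x) = nrm x := by
  rw [nrm_eq, rot_dot h, ← nrm_eq]

lemma nrm_eq_zero {k : ℕ} {x : Fin k → ℝ} : nrm x = 0 ↔ x = 0 := by
  rw [← dotProduct_self_eq_zero, ← nrm_sq]; simp

lemma ae_nrm_ne {k : ℕ} : ∀ᵐ g ∂(gam (k + 1)), nrm g ≠ 0 := by
  have h0 : ∀ᵐ t ∂(gaussianReal 0 1), t ≠ 0 := by
    have := nullSingletonClass_gaussianReal (μ := 0) (v := 1) one_ne_zero
    rw [ae_iff]
    simp
  have h1 : MeasurePreserving (fun g : Fin (k + 1) → ℝ => g 0) (gam (k + 1)) (gaussianReal 0 1) :=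
    measurePreserving_eval (fun _ => gaussianReal 0 1) 0
  filter_upwards [h1.quasiMeasurePreserving.ae h0] with g hg h
  rw [nrm_eq_zero] at h
  exact hg (by simp [h])

lemma cexp_bdd_integrable {α : Type*} [MeasurableSpace α] {μ : Measure α} [IsFiniteMeasure μ]
    {f : α → ℝ} (hf : Measurable f) :
    Integrable (fun x => Complex.exp ((f x : ℂ) * Complex.I)) μ := by
  refine Integrable.of_bound (C := 1) (Measurable.aestronglyMeasurable (by fun_prop)) ?_
  exact Filter.Eventually.of_forall fun x => by rw [Complex.norm_exp_ofReal_mul_I]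

/-- rotation invariant in the second coordinate implies uniform direction -/
lemma polar {m : ℕ} (μ : Measure (ℝ × (Fin (m + 1) → ℝ))) [IsProbabilityMeasure μ]
    (hμ : ∀ Q : Matrix (Fin (m + 1)) (Fin (m + 1)) ℝ, Q * Qᵀ = 1 → Qᵀ * Q = 1 →
      μ.map (fun p => (p.1, Q *ᵥ p.2)) = μ) :
    μ = (μ.prod (gam (m + 1))).map (fun p => (p.1.1, fun j => nrm p.1.2 / nrm p.2 * p.2 j)) := by
  have hT : Measurable (fun p : (ℝ × (Fin (m + 1) → ℝ)) × (Fin (m + 1) → ℝ) =>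
    (p.1.1, fun j => nrm p.1.2 / nrm p.2 * p.2 j)) := by fun_prop
  have : IsProbabilityMeasure ((μ.prod (gam (m + 1))).map
    (fun p => (p.1.1, fun j => nrm p.1.2 / nrm p.2 * p.2 j))) :=
    Measure.isProbabilityMeasure_map hT.aemeasurable
  apply Measure.ext_of_charFunDual
  ext L
  obtain ⟨s, t, hL⟩ : ∃ (s : ℝ) (t : Fin (m + 1) → ℝ), ∀ p, L p = s * p.1 + t ⬝ᵥ p.2 := by
    refine ⟨L (1, 0), fun i => L (0, Pi.single i 1), fun p => ?_⟩
    have hp : p = p.1 • ((1 : ℝ), (0 : Fin (m + 1) → ℝ)) +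
        ∑ i, p.2 i • ((0 : ℝ), (Pi.single i 1 : Fin (m + 1) → ℝ)) := by
      ext j
      · simp [Prod.fst_sum]
      · simp [Prod.snd_sum, Finset.sum_apply, Pi.single_apply]
    conv_lhs => rw [hp]
    rw [map_add, map_sum, map_smul]
    simp only [map_smul, smul_eq_mul, dotProduct]
    rw [mul_comm]
    congr 1
    exact Finset.sum_congr rfl fun i _ => mul_comm _ _
  rw [charFunDual_apply, charFunDual_apply, integral_map hT.aemeasurable
    (Measurable.aestronglyMeasurable (by fun_prop))]
  simp_rw [hL]
  have hinv : ∀ t' : Fin (m + 1) → ℝ, t' ⬝ᵥ t' = t ⬝ᵥ t →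
      ∫ p, Complex.exp (((s * p.1 + t ⬝ᵥ p.2 : ℝ) : ℂ) * Complex.I) ∂μ =
      ∫ p, Complex.exp (((s * p.1 + t' ⬝ᵥ p.2 : ℝ) : ℂ) * Complex.I) ∂μ := by
    intro t' ht
    obtain ⟨Q, h1, h2, h3⟩ := exists_rot t' t ht
    conv_lhs => rw [← hμ Q h1 h2]
    rw [integral_map (by fun_prop) (Measurable.aestronglyMeasurable (by fun_prop))]
    refine integral_congr_ae (Filter.Eventually.of_forall fun p => ?_)
    simp only
    rw [← h3, rot_dot h2]
  have hstep1 : ∫ p, Complex.exp (((s * p.1 + t ⬝ᵥ p.2 : ℝ) : ℂ) * Complex.I) ∂μ =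
      ∫ g, ∫ p, Complex.exp (((s * p.1 + (nrm t / nrm g) * (g ⬝ᵥ p.2) : ℝ) : ℂ) * Complex.I) ∂μ
        ∂(gam (m + 1)) := by
    have : ∀ᵐ g ∂(gam (m + 1)),
        ∫ p, Complex.exp (((s * p.1 + (nrm t / nrm g) * (g ⬝ᵥ p.2) : ℝ) : ℂ) * Complex.I) ∂μ =
        ∫ p, Complex.exp (((s * p.1 + t ⬝ᵥ p.2 : ℝ) : ℂ) * Complex.I) ∂μ := by
      filter_upwards [ae_nrm_ne] with g hg
      rw [hinv ((nrm t / nrm g) • g)]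
      · simp only [smul_dotProduct, smul_eq_mul]
      · rw [smul_dotProduct, dotProduct_smul, ← nrm_sq, ← nrm_sq, smul_eq_mul, smul_eq_mul]
        field_simp
    rw [integral_congr_ae this]
    simp
  rw [hstep1, integral_integral_swap (cexp_bdd_integrable (by fun_prop)),
    integral_prod _ (cexp_bdd_integrable (by fun_prop))]
  refine integral_congr_ae (Filter.Eventually.of_forall fun p => ?_)
  simp only
  obtain ⟨Q, h1, h2, h3⟩ := exists_rot (nrm t • p.2) (nrm p.2 • t) (by
    simp only [smul_dotProduct, dotProduct_smul, ← nrm_sq, smul_eq_mul]; ring)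
  conv_rhs => rw [← (gam_rot Q h1).map_eq]
  rw [integral_map (by fun_prop) (Measurable.aestronglyMeasurable (by fun_prop))]
  refine integral_congr_ae (Filter.Eventually.of_forall fun g => ?_)
  simp only
  congr 4
  have e : (fun j => nrm p.2 / nrm (Q *ᵥ g) * (Q *ᵥ g) j) = (nrm p.2 / nrm g) • (Q *ᵥ g) := by
    ext j; simp [nrm_rot h2]
  rw [e]
  have h4 : t ⬝ᵥ ((nrm p.2 / nrm g) • (Q *ᵥ g)) = (nrm g)⁻¹ * ((nrm p.2 • t) ⬝ᵥ (Q *ᵥ g)) := by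
    simp only [smul_dotProduct, dotProduct_smul, smul_eq_mul]; ring
  rw [h4, ← h3, rot_dot h2, smul_dotProduct, dotProduct_comm p.2 g, smul_eq_mul]
  ring

/-- The vector `w`. -/
def wvec {m d : ℕ} (r : ℝ) (u : Fin d → ℝ) (h : Fin m → ℝ) (G : Fin m → Fin d → ℝ) :
    Fin d → ℝ := fun a => r * (r * u a + ∑ i, h i * G i a)

/-- The reduced model. -/
def Tmap (m d : ℕ) (p : (Fin d → ℝ) × (Fin m → ℝ) × (Fin d → ℝ) × (Fin m → Fin d → ℝ)) :
    ℝ × (Fin m → ℝ) :=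
  ((p.2.2.1 ⬝ᵥ wvec (nrm p.1) p.2.2.1 p.2.1 p.2.2.2) / (d : ℝ) ^ 2,
    fun j => (p.2.2.2 j ⬝ᵥ wvec (nrm p.1) p.2.2.1 p.2.1 p.2.2.2) / (d : ℝ) ^ 2)

lemma measurable_Tmap (m d : ℕ) : Measurable (Tmap m d) := by
  unfold Tmap wvec; fun_prop

/-- Source measure of the reduced model. -/
def Pmod (m d : ℕ) :
    Measure ((Fin d → ℝ) × (Fin m → ℝ) × (Fin d → ℝ) × (Fin m → Fin d → ℝ)) :=
  (gam d).prod ((gam m).prod ((gam d).prod (Gam m d)))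

instance (m d : ℕ) : IsProbabilityMeasure (Pmod m d) := by unfold Pmod; infer_instance

lemma scale_vec (d : ℕ) (hd : d ≠ 0) :
    MeasurePreserving (fun (x : Fin d → ℝ) a => x a / √(d : ℝ)) (gam d) (stdGaussianVec d) := by
  refine measurePreserving_pi (fun _ => gaussianReal 0 1)
    (fun _ => gaussianReal 0 (d : NNReal)⁻¹) (f := fun _ t => t / √(d : ℝ))
    (fun _ => ⟨by fun_prop, ?_⟩)
  rw [gaussianReal_map_div_const]
  congr 1
  · simp
  · ext
    simp

instance (d : ℕ) : IsProbabilityMeasure (stdGaussianVec d) := by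
  unfold stdGaussianVec; infer_instance

lemma scale_model (d n : ℕ) (hd : d ≠ 0) :
    MeasurePreserving (fun (p : (Fin n → Fin d → ℝ) × (Fin n → Fin d → ℝ)) =>
      ((fun i a => p.1 i a / √(d : ℝ)), (fun i a => p.2 i a / √(d : ℝ))))
      ((Gam n d).prod (Gam n d)) (gaussianModel d n) := by
  have h1 : MeasurePreserving (fun (U : Fin n → Fin d → ℝ) i a => U i a / √(d : ℝ)) (Gam n d)
      (Measure.pi fun _ : Fin n => stdGaussianVec d) :=
    measurePreserving_pi (fun _ => gam d) (fun _ => stdGaussianVec d) (fun _ => scale_vec d hd)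
  exact h1.prod h1

lemma score_eq {m d : ℕ} (u v : Fin (m + 1) → Fin d → ℝ) (j : Fin (m + 1)) (hd : d ≠ 0) :
    scoreX (fun i a => u i a / √(d : ℝ)) (fun i a => v i a / √(d : ℝ)) j 0 =
      (u j ⬝ᵥ fun a => u 0 a * nrm (v 0) ^ 2 + ∑ l : Fin m, u l.succ a * (v l.succ ⬝ᵥ v 0))
        / (d : ℝ) ^ 2 := by
  have h0 : √(d : ℝ) * √(d : ℝ) = d := Real.mul_self_sqrt (Nat.cast_nonneg d)
  have hd' : (d : ℝ) ≠ 0 := Nat.cast_ne_zero.mpr hd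
  have hs : √(d : ℝ) ≠ 0 := by intro h; rw [h] at h0; simp at h0; exact hd' h0.symm
  have h4 : √(d : ℝ) ^ 4 = (d : ℝ) ^ 2 := by
    calc √(d : ℝ) ^ 4 = (√(d : ℝ) * √(d : ℝ)) ^ 2 := by ring
      _ = _ := by rw [h0]
  unfold scoreX Wcross
  simp only [dotProduct, Matrix.mulVec, Matrix.of_apply]
  rw [Finset.sum_div]
  refine Finset.sum_congr rfl fun a _ => ?_
  rw [nrm_sq]
  have e : ∑ b, (∑ i, u i a / √(d : ℝ) * (v i b / √(d : ℝ))) * (v 0 b / √(d : ℝ))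
      = (∑ i, u i a * (v i ⬝ᵥ v 0)) / √(d : ℝ) ^ 3 := by
    simp only [Finset.sum_mul, dotProduct, Finset.mul_sum, Finset.sum_div]
    rw [Finset.sum_comm]
    refine Finset.sum_congr rfl fun i _ => Finset.sum_congr rfl fun b _ => ?_
    field_simp
  rw [e, Fin.sum_univ_succ, ← h4]
  simp only [dotProduct]
  field_simp

lemma stage1 (m k : ℕ) :
    (gaussianModel (k + 1) (m + 1)).map
      (fun p => (scoreX p.1 p.2 0 0, fun j : Fin m => scoreX p.1 p.2 j.succ 0)) =
    (Pmod m (k + 1)).map (Tmap m (k + 1)) := by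
  have hmeas : Measurable (fun p : (Fin (m + 1) → Fin (k + 1) → ℝ) × (Fin (m + 1) → Fin (k + 1) → ℝ)
      => (scoreX p.1 p.2 0 0, fun j : Fin m => scoreX p.1 p.2 j.succ 0)) := by
    unfold scoreX Wcross Matrix.mulVec
    simp only [Matrix.of_apply, dotProduct]
    fun_prop
  rw [← (scale_model (k + 1) (m + 1) (by omega)).map_eq, Measure.map_map hmeas (by fun_prop)]
  -- the intermediate function
  let T' : ((Fin (k + 1) → ℝ) × (Fin m → Fin (k + 1) → ℝ)) ×
      ((Fin (k + 1) → ℝ) × (Fin m → Fin (k + 1) → ℝ)) → ℝ × (Fin m → ℝ) := fun p =>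
    ((p.1.1 ⬝ᵥ fun a => p.1.1 a * nrm p.2.1 ^ 2 + ∑ l : Fin m, p.1.2 l a * (p.2.2 l ⬝ᵥ p.2.1))
        / ((k + 1 : ℕ) : ℝ) ^ 2,
      fun j => (p.1.2 j ⬝ᵥ fun a => p.1.1 a * nrm p.2.1 ^ 2 +
        ∑ l : Fin m, p.1.2 l a * (p.2.2 l ⬝ᵥ p.2.1)) / ((k + 1 : ℕ) : ℝ) ^ 2)
  have hT' : Measurable T' := by fun_prop
  have hsp := (Gam_split m (k + 1)).prod (Gam_split m (k + 1))
  trans (((gam (k + 1)).prod (Gam m (k + 1))).prod ((gam (k + 1)).prod (Gam m (k + 1)))).map T'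
  · rw [← hsp.map_eq, Measure.map_map hT' hsp.measurable]
    congr 1
    funext p
    simp only [Function.comp]
    ext j
    · exact score_eq _ _ _ (by omega)
    · exact score_eq _ _ _ (by omega)
  let T'' : ((Fin (k + 1) → ℝ) × (Fin m → Fin (k + 1) → ℝ)) ×
      ((Fin (k + 1) → ℝ) × (Fin m → ℝ)) → ℝ × (Fin m → ℝ) := fun p =>
    Tmap m (k + 1) (p.2.1, p.2.2, p.1.1, p.1.2)
  have hT'' : Measurable T'' := (measurable_Tmap _ _).comp (by fun_prop)
  trans (((gam (k + 1)).prod (Gam m (k + 1))).prod ((gam (k + 1)).prod (gam m))).map T''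
  · refine map_skew hT' hT'' fun ⟨u, G⟩ => ?_
    refine map_skew (by fun_prop) (by fun_prop) fun v => ?_
    let Φ : (Fin m → ℝ) → ℝ × (Fin m → ℝ) := fun y =>
      ((u ⬝ᵥ fun a => u a * nrm v ^ 2 + ∑ l : Fin m, G l a * y l) / ((k + 1 : ℕ) : ℝ) ^ 2,
        fun j => (G j ⬝ᵥ fun a => u a * nrm v ^ 2 + ∑ l : Fin m, G l a * y l)
          / ((k + 1 : ℕ) : ℝ) ^ 2)
    have hΦ : Measurable Φ := by fun_prop
    have e1 : (fun V => T' ((u, G), (v, V))) = Φ ∘ (fun V i => V i ⬝ᵥ v) := rfl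
    have e2 : (fun h => T'' ((u, G), (v, h))) = Φ ∘ (fun h i => nrm v * h i) := by
      funext h
      have : wvec (nrm v) u h G = fun a => u a * nrm v ^ 2 + ∑ l : Fin m, G l a * (nrm v * h l) := by
        funext a
        simp only [wvec]
        rw [mul_add, Finset.mul_sum]
        congr 1
        · ring
        · exact Finset.sum_congr rfl fun i _ => by ring
      simp only [T'', Tmap, Φ, Function.comp, this]
    rw [e1, e2, ← Measure.map_map hΦ (by fun_prop), ← Measure.map_map hΦ (by fun_prop), dots_law]
  · have h1 := (measurePreserving_prodAssoc (gam (k + 1)) (gam m)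
      ((gam (k + 1)).prod (Gam m (k + 1)))).comp
      (Measure.measurePreserving_swap (μ := (gam (k + 1)).prod (Gam m (k + 1)))
        (ν := (gam (k + 1)).prod (gam m)))
    unfold Pmod
    rw [← h1.map_eq, Measure.map_map (measurable_Tmap _ _) h1.measurable]
    rfl

lemma stage2 (m d : ℕ) (Q : Matrix (Fin m) (Fin m) ℝ) (h1 : Q * Qᵀ = 1) (h2 : Qᵀ * Q = 1) :
    ((Pmod m d).map (Tmap m d)).map (fun p => (p.1, Q *ᵥ p.2)) = (Pmod m d).map (Tmap m d) := by
  have hp := (MeasurePreserving.id (gam d)).prod ((gam_rot Q h1).prod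
    ((MeasurePreserving.id (gam d)).prod (Gam_rot d Q h1)))
  rw [Measure.map_map (by fun_prop) (measurable_Tmap _ _)]
  conv_rhs => unfold Pmod; rw [← hp.map_eq]
  rw [Measure.map_map (measurable_Tmap _ _) hp.measurable]
  unfold Pmod
  congr 1
  funext ⟨v, h, u, G⟩
  have hw : wvec (nrm v) u (Q *ᵥ h) (fun i a => (Q *ᵥ fun k => G k a) i) = wvec (nrm v) u h G := by
    funext a
    simp only [wvec]
    have := rot_dot h2 h (fun k => G k a)
    simp only [dotProduct] at this
    rw [this]
  simp only [Function.comp, Tmap, Prod.map, id, hw]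
  congr 1
  funext j
  simp only [Matrix.mulVec, dotProduct, Finset.sum_mul, Finset.mul_sum, Finset.sum_div]
  rw [Finset.sum_comm]
  refine Finset.sum_congr rfl fun i _ => Finset.sum_congr rfl fun b _ => ?_
  ring

/-- Radial part. -/
def Rmap (D r1 r3 r2 a r4 r5 : ℝ) : ℝ × ℝ :=
  (r1 * r2 * (r1 * r2 + r3 * a) / D,
    r1 * √((a * (r1 * r2 + r3 * a) + r3 * r4 ^ 2) ^ 2 +
      ((r1 * r2 + r3 * a) ^ 2 + r3 ^ 2 * r4 ^ 2) * r5 ^ 2) / D)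

lemma nrm_div {k : ℕ} (x : Fin k → ℝ) (D : ℝ) (hD : 0 ≤ D) :
    nrm (fun j => x j / D) = √(x ⬝ᵥ x) / D := by
  unfold nrm
  simp only [div_pow]
  rw [← Finset.sum_div, Real.sqrt_div' _ (sq_nonneg D), Real.sqrt_sq hD]
  simp [dotProduct, sq]

lemma stage4_inner (l k : ℕ) (v u : Fin (k + 1) → ℝ) (h : Fin (l + 1) → ℝ) :
    (Gam (l + 1) (k + 1)).map (fun G => ((Tmap (l + 1) (k + 1) (v, h, u, G)).1,
      nrm (Tmap (l + 1) (k + 1) (v, h, u, G)).2)) =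
    ((gaussianReal 0 1).prod ((gam k).prod (gam l))).map
      (fun p => Rmap (((k + 1 : ℕ) : ℝ) ^ 2) (nrm v) (nrm h) (nrm u) p.1 (nrm p.2.1) (nrm p.2.2)) := by
  set D : ℝ := ((k + 1 : ℕ) : ℝ) ^ 2 with hD
  have hD0 : 0 ≤ D := by positivity
  set r1 := nrm v with hr1
  have hr1' : 0 ≤ r1 := nrm_nonneg v
  set r3 := nrm h with hr3
  set r2 := nrm u with hr2
  -- rotated version
  let w1 : (Fin (k + 1) → ℝ) → (Fin (k + 1) → ℝ) := fun z a => r1 * (r1 * u a + r3 * z a)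
  let f1 : (Fin (l + 1) → Fin (k + 1) → ℝ) → ℝ × ℝ := fun G =>
    (u ⬝ᵥ w1 (G 0) / D, √(∑ j, (G j ⬝ᵥ w1 (G 0)) ^ 2) / D)
  have hf1 : Measurable f1 := by fun_prop
  obtain ⟨Q, h1, h2, h3⟩ := exists_rot_e0 h
  have hrot := Gam_rot (k + 1) Q h1
  trans (Gam (l + 1) (k + 1)).map f1
  · conv_rhs => rw [← hrot.map_eq]
    rw [Measure.map_map hf1 hrot.measurable]
    congr 1
    funext G
    have hw : w1 (fun a => (Q *ᵥ fun k => G k a) 0) = wvec r1 u h G := by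
      funext a
      simp only [w1, wvec]
      have := rot_dot h2 h (fun k => G k a)
      rw [h3, single_dotProduct] at this
      rw [hr3, this]
      rfl
    simp only [Function.comp, Tmap, f1]
    rw [nrm_div _ _ hD0, hw]
    congr 3
    rw [← rot_dot h2]
    simp only [dotProduct, ← sq]
    refine Finset.sum_congr rfl fun j _ => ?_
    congr 1
    simp only [Matrix.mulVec, dotProduct, Finset.sum_mul, Finset.mul_sum]
    rw [Finset.sum_comm]
    refine Finset.sum_congr rfl fun i _ => Finset.sum_congr rfl fun b _ => ?_
    ring
  let f2 : (Fin (k + 1) → ℝ) × (Fin l → Fin (k + 1) → ℝ) → ℝ × ℝ := fun p =>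
    (u ⬝ᵥ w1 p.1 / D, √((p.1 ⬝ᵥ w1 p.1) ^ 2 + nrm (fun j => p.2 j ⬝ᵥ w1 p.1) ^ 2) / D)
  have hf2 : Measurable f2 := by fun_prop
  have hs := Gam_split l (k + 1)
  trans ((gam (k + 1)).prod (Gam l (k + 1))).map f2
  · rw [← hs.map_eq, Measure.map_map hf2 hs.measurable]
    congr 1
    funext G
    simp only [f1, f2, Function.comp]
    rw [Fin.sum_univ_succ, nrm_sq]
    simp [dotProduct, sq]
  let f3 : (Fin (k + 1) → ℝ) × (Fin l → ℝ) → ℝ × ℝ := fun p =>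
    (u ⬝ᵥ w1 p.1 / D, √((p.1 ⬝ᵥ w1 p.1) ^ 2 + nrm (fun j => nrm (w1 p.1) * p.2 j) ^ 2) / D)
  have hf3 : Measurable f3 := by fun_prop
  trans ((gam (k + 1)).prod (gam l)).map f3
  · refine map_skew hf2 hf3 fun z => ?_
    let Φ : (Fin l → ℝ) → ℝ × ℝ := fun y =>
      (u ⬝ᵥ w1 z / D, √((z ⬝ᵥ w1 z) ^ 2 + nrm y ^ 2) / D)
    have hΦ : Measurable Φ := by fun_prop
    have e1 : (fun y => f2 (z, y)) = Φ ∘ (fun V j => V j ⬝ᵥ w1 z) := rfl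
    have e2 : (fun y => f3 (z, y)) = Φ ∘ (fun V j => nrm (w1 z) * V j) := rfl
    rw [e1, e2, ← Measure.map_map hΦ (by fun_prop), ← Measure.map_map hΦ (by fun_prop), dots_law]
  let f4 : (ℝ × ℝ) × (Fin l → ℝ) → ℝ × ℝ := fun p =>
    (r1 * (r1 * r2 ^ 2 + r3 * p.1.1) / D,
      √((r1 * (r1 * p.1.1 + r3 * p.1.2)) ^ 2 +
        r1 ^ 2 * (r1 ^ 2 * r2 ^ 2 + 2 * r1 * r3 * p.1.1 + r3 ^ 2 * p.1.2) * nrm p.2 ^ 2) / D)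
  have hf4 : Measurable f4 := by fun_prop
  have e3 : f3 = f4 ∘ Prod.map (fun z => (u ⬝ᵥ z, z ⬝ᵥ z)) id := by
    funext ⟨z, y⟩
    have hw : w1 z = r1 • (r1 • u + r3 • z) := rfl
    have hy : nrm (fun j => nrm (w1 z) * y j) ^ 2 = nrm (w1 z) ^ 2 * nrm y ^ 2 := by
      have : (fun j => nrm (w1 z) * y j) = nrm (w1 z) • y := rfl
      rw [this, nrm_sq, nrm_sq y, smul_dotProduct, dotProduct_smul, smul_eq_mul, smul_eq_mul]
      ring
    simp only [f3, f4, Function.comp, Prod.map, id]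
    rw [hy, nrm_sq (w1 z), hw]
    simp only [smul_dotProduct, dotProduct_smul, add_dotProduct, dotProduct_add, smul_eq_mul,
      dotProduct_comm z u, ← nrm_sq u]
    rw [← hr2]
    congr 4
    ring
  rw [e3, ← Measure.map_map hf4 (by fun_prop),
    ← Measure.map_prod_map _ _ (by fun_prop) measurable_id, dot_pair_law,
    Measure.map_prod_map _ _ (by fun_prop) measurable_id, Measure.map_map hf4 (by fun_prop)]
  have ha := measurePreserving_prodAssoc (gaussianReal 0 1) (gam k) (gam l)
  have hR : Measurable (fun p : ℝ × (Fin k → ℝ) × (Fin l → ℝ) =>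
      Rmap D r1 r3 r2 p.1 (nrm p.2.1) (nrm p.2.2)) := by
    unfold Rmap; fun_prop
  rw [← ha.map_eq, Measure.map_map hR ha.measurable]
  congr 1
  funext ⟨⟨a, c⟩, y⟩
  simp only [Function.comp, f4, Prod.map, id, Rmap, MeasurableEquiv.prodAssoc,
    MeasurableEquiv.coe_mk, Equiv.prodAssoc_apply]
  rw [← Real.sqrt_sq hr1', ← Real.sqrt_mul (sq_nonneg _), Real.sqrt_sq hr1', ← hr2]
  congr 2
  · ring
  · congr 1
    ring

lemma chi_mp (k : ℕ) (c : ℝ) :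
    MeasurePreserving (fun x : Fin k → ℝ => nrm x / c) (gam k) (scaledChi k c) := by
  refine ⟨by fun_prop, ?_⟩
  unfold scaledChi chiDist
  rw [Measure.map_map (by fun_prop) (by fun_prop)]
  rfl

lemma scaledChi_prob (k : ℕ) (c : ℝ) : IsProbabilityMeasure (scaledChi k c) := by
  rw [← (chi_mp k c).map_eq]
  exact Measure.isProbabilityMeasure_map (by fun_prop)

instance (k : ℕ) (c : ℝ) : SFinite (scaledChi k c) := by
  have := scaledChi_prob k c
  infer_instance

lemma sw3 {α β γ : Type*} [MeasurableSpace α] [MeasurableSpace β] [MeasurableSpace γ]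
    (μ : Measure α) (ν : Measure β) (ρ : Measure γ) [SFinite μ] [SFinite ν] [SFinite ρ] :
    MeasurePreserving (fun p : α × β × γ => (p.2.1, p.1, p.2.2)) (μ.prod (ν.prod ρ))
      (ν.prod (μ.prod ρ)) := by
  have h1 := (measurePreserving_prodAssoc μ ν ρ).symm
  have h2 := (Measure.measurePreserving_swap (μ := μ) (ν := ν)).prod (MeasurePreserving.id ρ)
  exact (measurePreserving_prodAssoc ν μ ρ).comp (h2.comp h1)

lemma reorder {V H U A R G : Type*} [MeasurableSpace V] [MeasurableSpace H] [MeasurableSpace U]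
    [MeasurableSpace A] [MeasurableSpace R] [MeasurableSpace G]
    (v : Measure V) (h : Measure H) (u : Measure U) (a : Measure A) (r : Measure R) (g : Measure G)
    [SFinite v] [SFinite h] [SFinite u] [SFinite a] [SFinite r] [SFinite g] :
    MeasurePreserving (fun p : (V × H × U × A × R) × G =>
      (p.1.2.2.2.1, p.2, p.1.1, p.1.2.2.1, p.1.2.1, p.1.2.2.2.2))
      ((v.prod (h.prod (u.prod (a.prod r)))).prod g)
      (a.prod (g.prod (v.prod (u.prod (h.prod r))))) := by
  have s1 := (MeasurePreserving.id v).prod ((MeasurePreserving.id h).prod (sw3 u a r))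
  have s2 := (MeasurePreserving.id v).prod (sw3 h a (u.prod r))
  have s3 := sw3 v a (h.prod (u.prod r))
  have s4 := (MeasurePreserving.id a).prod ((MeasurePreserving.id v).prod (sw3 h u r))
  have s5 := s4.comp (s3.comp (s2.comp s1))
  have s6 := (MeasurePreserving.id g).prod s5
  have s7 := sw3 g a (v.prod (u.prod (h.prod r)))
  exact s7.comp (s6.comp Measure.measurePreserving_swap)

lemma stage4 (l k : ℕ) :
    ((Pmod (l + 1) (k + 1)).map (Tmap (l + 1) (k + 1))).map (fun p => (p.1, nrm p.2)) =
    ((gam (k + 1)).prod ((gam (l + 1)).prod ((gam (k + 1)).prod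
      ((gaussianReal 0 1).prod ((gam k).prod (gam l)))))).map
      (fun p => Rmap (((k + 1 : ℕ) : ℝ) ^ 2) (nrm p.1) (nrm p.2.1) (nrm p.2.2.1)
        p.2.2.2.1 (nrm p.2.2.2.2.1) (nrm p.2.2.2.2.2)) := by
  have hT := measurable_Tmap (l + 1) (k + 1)
  rw [Measure.map_map (by fun_prop) hT]
  unfold Pmod
  have hR : Measurable (fun p : (Fin (k + 1) → ℝ) × (Fin (l + 1) → ℝ) × (Fin (k + 1) → ℝ) ×
      ℝ × (Fin k → ℝ) × (Fin l → ℝ) =>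
      Rmap (((k + 1 : ℕ) : ℝ) ^ 2) (nrm p.1) (nrm p.2.1) (nrm p.2.2.1)
        p.2.2.2.1 (nrm p.2.2.2.2.1) (nrm p.2.2.2.2.2)) := by
    unfold Rmap; fun_prop
  have hL : Measurable ((fun p : ℝ × (Fin (l + 1) → ℝ) => (p.1, nrm p.2)) ∘
    Tmap (l + 1) (k + 1)) := Measurable.comp (by fun_prop) hT
  refine map_skew hL hR fun v => ?_
  refine map_skew (hL.comp measurable_prodMk_left) (hR.comp measurable_prodMk_left) fun h => ?_
  refine map_skew (hL.comp (measurable_prodMk_left.comp measurable_prodMk_left))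
    (hR.comp (measurable_prodMk_left.comp measurable_prodMk_left)) fun u => ?_
  exact stage4_inner l k v u h

lemma final_alg (l k : ℕ) (x1 x2 x3 x4 x5 a : ℝ) (N : ℝ)
    (D n : ℝ) (hDdef : D = ((k + 1 : ℕ) : ℝ)) (hndef : n = ((l + 2 : ℕ) : ℝ)) :
    x1 / √D * (x2 / √D) * (x1 / √D * (x2 / √D) + √(n / D ^ 2) * (x3 / √n) * a)
      = x1 * x2 * (x1 * x2 + x3 * a) / D ^ 2 ∧
    x1 / √D * (√((a * (x1 / √D * (x2 / √D) + √(n / D ^ 2) * (x3 / √n) * a) / √n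
        + x3 / √n * (x4 / √D) ^ 2) ^ 2 / D +
          (x1 / √D * (x2 / √D) + √(n / D ^ 2) * (x3 / √n) * a) ^ 2 * (x5 / √n) ^ 2 / D +
            n / D ^ 2 * (x3 / √n) ^ 2 * (x4 / √D) ^ 2 * (x5 / √n) ^ 2) / (N / √n)) =
      x1 * √((a * (x1 * x2 + x3 * a) + x3 * x4 ^ 2) ^ 2 +
      ((x1 * x2 + x3 * a) ^ 2 + x3 ^ 2 * x4 ^ 2) * x5 ^ 2) / D ^ 2 / N := by
  have hD : 0 < D := by rw [hDdef]; positivity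
  have hn : 0 < n := by rw [hndef]; positivity
  obtain ⟨e, he, rfl⟩ : ∃ e : ℝ, 0 < e ∧ D = e ^ 2 := ⟨√D, by positivity, by rw [Real.sq_sqrt hD.le]⟩
  obtain ⟨f, hf, rfl⟩ : ∃ f : ℝ, 0 < f ∧ n = f ^ 2 := ⟨√n, by positivity, by rw [Real.sq_sqrt hn.le]⟩
  have h1 : √(f ^ 2 / (e ^ 2) ^ 2) = f / e ^ 2 := by
    rw [← div_pow, Real.sqrt_sq (by positivity)]
  rw [h1, Real.sqrt_sq he.le, Real.sqrt_sq hf.le]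
  refine ⟨by field_simp, ?_⟩
  have h2 : ((a * (x1 / e * (x2 / e) + f / e ^ 2 * (x3 / f) * a) / f
        + x3 / f * (x4 / e) ^ 2) ^ 2 / e ^ 2 +
          (x1 / e * (x2 / e) + f / e ^ 2 * (x3 / f) * a) ^ 2 * (x5 / f) ^ 2 / e ^ 2 +
            f ^ 2 / (e ^ 2) ^ 2 * (x3 / f) ^ 2 * (x4 / e) ^ 2 * (x5 / f) ^ 2)
      = ((a * (x1 * x2 + x3 * a) + x3 * x4 ^ 2) ^ 2 +
      ((x1 * x2 + x3 * a) ^ 2 + x3 ^ 2 * x4 ^ 2) * x5 ^ 2) / (e ^ 3 * f) ^ 2 := by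
    field_simp
    ring
  rw [h2, Real.sqrt_div' _ (sq_nonneg _), Real.sqrt_sq (by positivity)]
  by_cases hN : N = 0
  · simp [hN]
  · field_simp

lemma final_law (l k : ℕ) :
    (gaussianModel (k + 1) (l + 2)).map
      (fun p => (scoreX p.1 p.2 0 0, fun j : Fin (l + 1) => scoreX p.1 p.2 j.succ 0)) =
    Measure.map
      (fun q : ℝ × (Fin (l + 1) → ℝ) × ℝ × ℝ × ℝ × ℝ × ℝ =>
        let a := q.1
        let g := q.2.1
        let ρ₁ := q.2.2.1
        let ρ₂ := q.2.2.2.1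
        let ρ₃ := q.2.2.2.2.1
        let ρ₄ := q.2.2.2.2.2.1
        let ρ₅ := q.2.2.2.2.2.2
        let s := ρ₁ * ρ₂ + Real.sqrt (((l + 2 : ℕ) : ℝ) / ((k + 1 : ℕ) : ℝ) ^ 2) * ρ₃ * a
        let r := Real.sqrt ((a * s / Real.sqrt ((l + 2 : ℕ) : ℝ) + ρ₃ * ρ₄ ^ 2) ^ 2 / ((k + 1 : ℕ) : ℝ) +
          s ^ 2 * ρ₅ ^ 2 / ((k + 1 : ℕ) : ℝ) +
            ((l + 2 : ℕ) : ℝ) / ((k + 1 : ℕ) : ℝ) ^ 2 * ρ₃ ^ 2 * ρ₄ ^ 2 * ρ₅ ^ 2)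
        ((ρ₁ * ρ₂ * s : ℝ),
          fun j : Fin (l + 1) =>
            ρ₁ * (r / (Real.sqrt (∑ t, g t ^ 2) / Real.sqrt ((l + 2 : ℕ) : ℝ))) * g j))
      ((gaussianReal 0 1).prod
        ((gam (l + 1)).prod
          ((scaledChi (k + 1) (Real.sqrt ((k + 1 : ℕ) : ℝ))).prod
            ((scaledChi (k + 1) (Real.sqrt ((k + 1 : ℕ) : ℝ))).prod
              ((scaledChi (l + 1) (Real.sqrt ((l + 2 : ℕ) : ℝ))).prod
                ((scaledChi k (Real.sqrt ((k + 1 : ℕ) : ℝ))).prod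
                  (scaledChi l (Real.sqrt ((l + 2 : ℕ) : ℝ))))))))) := by
  have hT := measurable_Tmap (l + 1) (k + 1)
  have hprob : IsProbabilityMeasure ((Pmod (l + 1) (k + 1)).map (Tmap (l + 1) (k + 1))) :=
    Measure.isProbabilityMeasure_map hT.aemeasurable
  rw [stage1, polar _ (fun Q h1 h2 => stage2 (l + 1) (k + 1) Q h1 h2)]
  set μ := (Pmod (l + 1) (k + 1)).map (Tmap (l + 1) (k + 1)) with hμ
  let K : (ℝ × ℝ) × (Fin (l + 1) → ℝ) → ℝ × (Fin (l + 1) → ℝ) := fun p =>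
    (p.1.1, fun j => p.1.2 / nrm p.2 * p.2 j)
  have hK : Measurable K := by fun_prop
  have e1 : (fun p : (ℝ × (Fin (l + 1) → ℝ)) × (Fin (l + 1) → ℝ) =>
      (p.1.1, fun j => nrm p.1.2 / nrm p.2 * p.2 j))
      = K ∘ Prod.map (fun p => (p.1, nrm p.2)) id := rfl
  have hR : Measurable (fun p : (Fin (k + 1) → ℝ) × (Fin (l + 1) → ℝ) × (Fin (k + 1) → ℝ) ×
      ℝ × (Fin k → ℝ) × (Fin l → ℝ) =>
      Rmap (((k + 1 : ℕ) : ℝ) ^ 2) (nrm p.1) (nrm p.2.1) (nrm p.2.2.1)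
        p.2.2.2.1 (nrm p.2.2.2.2.1) (nrm p.2.2.2.2.2)) := by
    unfold Rmap; fun_prop
  rw [e1, ← Measure.map_map hK (by fun_prop),
    ← Measure.map_prod_map _ _ (by fun_prop) measurable_id, stage4,
    Measure.map_prod_map _ _ hR measurable_id, Measure.map_map hK (hR.prodMap measurable_id)]
  have c1 := chi_mp (k + 1) (Real.sqrt ((k + 1 : ℕ) : ℝ))
  have c3 := chi_mp (l + 1) (Real.sqrt ((l + 2 : ℕ) : ℝ))
  have c4 := chi_mp k (Real.sqrt ((k + 1 : ℕ) : ℝ))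
  have c5 := chi_mp l (Real.sqrt ((l + 2 : ℕ) : ℝ))
  have c := (MeasurePreserving.id (gaussianReal 0 1)).prod
    ((MeasurePreserving.id (gam (l + 1))).prod (c1.prod (c1.prod (c3.prod (c4.prod c5)))))
  have hc := c.comp (reorder (gam (k + 1)) (gam (l + 1)) (gam (k + 1)) (gaussianReal 0 1)
    ((gam k).prod (gam l)) (gam (l + 1)))
  rw [← hc.map_eq, Measure.map_map (by fun_prop) hc.measurable]
  congr 1
  funext ⟨⟨v, h, u, a, c, y⟩, g⟩
  obtain ⟨A, B⟩ := final_alg l k (nrm v) (nrm u) (nrm h) (nrm c) (nrm y) a (nrm g) _ _ rfl rfl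
  refine Prod.ext ?_ (funext fun j => ?_)
  · exact A.symm
  · exact congrArg (· * g j) B.symm

/-- **Law of a single coordinate of the score matrix.** Let `(θ, ξ) = S e₁` be the
first column of `S = U^⊤U V^⊤V`. With `a ∼ N(0,1)`, `g ∼ N(0,I_{n−1})`,
`ρ₁, ρ₂ ∼ χ(d)/√d`, `ρ₃ ∼ χ(n−1)/√n`, `ρ₄ ∼ χ(d−1)/√d`, `ρ₅ ∼ χ(n−2)/√n` all
mutually independent (realized on the product space below), and
`s = ρ₁ρ₂ + √(n/d²) ρ₃ a`,
`r = √( (a s/√n + ρ₃ρ₄²)²/d + s²ρ₅²/d + (n/d²) ρ₃²ρ₄²ρ₅² )`,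
the pair `(θ, ξ)` has the same distribution as `(ρ₁ρ₂ s, ρ₁ (r/(‖g‖/√n)) g)`. -/
theorem single_coordinate_law (n d : ℕ) (hn : 3 ≤ n) (hd : 2 ≤ d) :
    Measure.map
      (fun p : (Fin n → Fin d → ℝ) × (Fin n → Fin d → ℝ) =>
        ((scoreX p.1 p.2 ⟨0, by omega⟩ ⟨0, by omega⟩ : ℝ),
          fun j : Fin (n - 1) =>
            scoreX p.1 p.2 ⟨j.1 + 1, by have := j.isLt; omega⟩ ⟨0, by omega⟩))
      (gaussianModel d n) =
    Measure.map
      (fun q : ℝ × (Fin (n - 1) → ℝ) × ℝ × ℝ × ℝ × ℝ × ℝ =>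
        let a := q.1
        let g := q.2.1
        let ρ₁ := q.2.2.1
        let ρ₂ := q.2.2.2.1
        let ρ₃ := q.2.2.2.2.1
        let ρ₄ := q.2.2.2.2.2.1
        let ρ₅ := q.2.2.2.2.2.2
        let s := ρ₁ * ρ₂ + Real.sqrt ((n : ℝ) / (d : ℝ) ^ 2) * ρ₃ * a
        let r := Real.sqrt ((a * s / Real.sqrt n + ρ₃ * ρ₄ ^ 2) ^ 2 / d +
          s ^ 2 * ρ₅ ^ 2 / d + (n : ℝ) / (d : ℝ) ^ 2 * ρ₃ ^ 2 * ρ₄ ^ 2 * ρ₅ ^ 2)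
        ((ρ₁ * ρ₂ * s : ℝ),
          fun j : Fin (n - 1) =>
            ρ₁ * (r / (Real.sqrt (∑ t, g t ^ 2) / Real.sqrt n)) * g j))
      ((gaussianReal 0 1).prod
        ((Measure.pi fun _ : Fin (n - 1) => gaussianReal 0 1).prod
          ((scaledChi d (Real.sqrt d)).prod
            ((scaledChi d (Real.sqrt d)).prod
              ((scaledChi (n - 1) (Real.sqrt n)).prod
                ((scaledChi (d - 1) (Real.sqrt d)).prod
                  (scaledChi (n - 2) (Real.sqrt n)))))))) := by
  obtain ⟨l, rfl⟩ : ∃ l, n = l + 2 := ⟨n - 2, by omega⟩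
  obtain ⟨k, rfl⟩ : ∃ k, d = k + 1 := ⟨d - 1, by omega⟩
  exact final_law l k

end
end
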